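/- Let n ≥ 2 and let λ₁ ≥ λ₂ ≥ ⋯ ≥ λ_{n−1} > 0 be real numbers. Then there exists a real symmetric n×n matrix L with L_{ij} < 0 for all i ≠ j and zero row sums (L·1_n = 0) whose characteristic polynomial equals X·∏_{i=1}^{n−1}(X − λᵢ); in particular, the eigenvalues of L, counted with multiplicity, are exactly λ₁, …, λ_{n−1} together with a simple eigenvalue 0. -/

import Mathlib

open Matrix Polynomial

/-- The unnormalised Helmert vectors: the all-ones vector for `k = 0`, and
`(1, …, 1, -k, 0, …)` with `k` leading ones for `k > 0`. -/
def helmert (k i : ℕ) : ℝ :=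
  if k = 0 then 1 else if i < k then 1 else if i = k then -k else 0

theorem sum_helmert_mul {k : ℕ} (hk : k ≠ 0) (f : ℕ → ℝ) {n : ℕ} (hn : k < n) :
    ∑ i ∈ Finset.range n, helmert k i * f i = ∑ i ∈ Finset.range k, f i - k * f k := by
  induction n, hn using Nat.le_induction with
  | base =>
    rw [Finset.sum_range_succ, sub_eq_add_neg]
    congr 1
    · refine Finset.sum_congr rfl fun i hi => ?_
      simp [helmert, hk, Finset.mem_range.mp hi]
    · simp [helmert, hk]
  | succ n hn ih =>
    have h1 : ¬ n < k := by omega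
    have h2 : n ≠ k := by omega
    rw [Finset.sum_range_succ, ih]
    simp [helmert, hk, h1, h2]

theorem sum_helmert_eq_zero {k : ℕ} (hk : k ≠ 0) {n : ℕ} (hn : k < n) :
    ∑ i ∈ Finset.range n, helmert k i = 0 := by
  simpa using sum_helmert_mul hk (fun _ => 1) hn

theorem sum_helmert_mul_helmert_of_lt {k l : ℕ} (hkl : k < l) {n : ℕ} (hn : l < n) :
    ∑ i ∈ Finset.range n, helmert l i * helmert k i = 0 := by
  rw [sum_helmert_mul (by omega) _ hn]
  rcases eq_or_ne k 0 with rfl | hk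
  · simp [helmert]
  · have h1 : ¬ l < k := by omega
    have h2 : l ≠ k := by omega
    rw [sum_helmert_eq_zero hk hkl]
    simp [helmert, hk, h1, h2]

theorem sum_helmert_mul_self {k : ℕ} (hk : k ≠ 0) {n : ℕ} (hn : k < n) :
    ∑ i ∈ Finset.range n, helmert k i * helmert k i = k * (k + 1) := by
  have h : ∑ i ∈ Finset.range k, helmert k i = k := by
    rw [Finset.sum_congr rfl (g := fun _ => (1 : ℝ))]
    · simp
    · intro i hi
      simp [helmert, hk, Finset.mem_range.mp hi]
  rw [sum_helmert_mul hk _ hn, h]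
  simp [helmert, hk]
  ring

theorem sum_weighted_helmert_le {d : ℕ → ℝ} (hd : d 0 = 0) {i j : ℕ} (hij : i < j)
    (hanti : ∀ k, j ≤ k → d k ≤ d j) {n : ℕ} (hn : j < n) :
    ∑ k ∈ Finset.range n, helmert k i * (d k / (k * (k + 1)) * helmert k j) ≤ -d j / n := by
  have hj : j ≠ 0 := by omega
  induction n, hn using Nat.le_induction with
  | base =>
    rw [Finset.sum_range_succ, Finset.sum_eq_zero]
    · have : (j : ℝ) ≠ 0 := by exact_mod_cast hj
      have h' : (j : ℝ) + 1 ≠ 0 := by positivity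
      apply le_of_eq
      simp [helmert, hj, hij]
      field_simp
    · intro k hk
      have hk := Finset.mem_range.mp hk
      rcases eq_or_ne k 0 with rfl | hk0
      · simp [hd]
      · have h1 : ¬ j < k := by omega
        have h2 : j ≠ k := by omega
        simp [helmert, hk0, h1, h2]
  | succ n hn ih =>
    have hn' : j < n := hn
    have h0 : n ≠ 0 := by omega
    have h1 : i < n := by omega
    have hpos : (0 : ℝ) < n := by exact_mod_cast Nat.pos_of_ne_zero h0
    rw [Finset.sum_range_succ]
    have hle : d n / (n * (n + 1)) ≤ d j / (n * (n + 1)) := by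
      gcongr
      exact hanti n hn'.le
    have hsum : -d j / n + d j / (n * (n + 1)) = -d j / ((n + 1 : ℕ) : ℝ) := by
      push_cast
      field_simp
      ring
    simp only [helmert, h0, h1, hn', if_true, if_false, one_mul, mul_one] at ih ⊢
    linarith

theorem exists_laplacian_charpoly_eq_prod {n : ℕ} {d : ℕ → ℝ} (hd : d 0 = 0)
    (hanti : ∀ j k, j ≠ 0 → j ≤ k → d k ≤ d j) (hpos : ∀ k, k ≠ 0 → k < n → 0 < d k) :
    ∃ L : Matrix (Fin n) (Fin n) ℝ,
      L.IsSymm ∧ (∀ i j, i ≠ j → L i j < 0) ∧ (L *ᵥ (fun _ => (1 : ℝ)) = 0) ∧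
      L.charpoly = ∏ k : Fin n, (X - C (d k)) := by
  let H : Matrix (Fin n) (Fin n) ℝ := Matrix.of fun i k => helmert k i
  let D : Matrix (Fin n) (Fin n) ℝ :=
    Matrix.diagonal fun k => d k / ((k : ℕ) * ((k : ℕ) + 1))
  have hsymm : (H * (D * Hᵀ)).IsSymm := by
    simp [Matrix.IsSymm, Matrix.transpose_mul, D, Matrix.mul_assoc]
  have hlt : ∀ i j : Fin n, i < j → (H * (D * Hᵀ)) i j < 0 := by
    intro i j hij
    have hij' : (i : ℕ) < j := hij
    have hj : (j : ℕ) ≠ 0 := by omega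
    have hle := sum_weighted_helmert_le hd hij' (fun k hk => hanti j k hj hk) j.isLt
    rw [← Fin.sum_univ_eq_sum_range
      (fun k => helmert k i * (d k / (k * (k + 1)) * helmert k j)) n] at hle
    have hn : (0 : ℝ) < n := by exact_mod_cast i.pos
    have hneg : -d j / n < 0 := div_neg_of_neg_of_pos (neg_lt_zero.mpr (hpos j hj j.isLt)) hn
    rw [Matrix.mul_apply]
    simp only [D, H, Matrix.diagonal_mul, Matrix.transpose_apply, Matrix.of_apply]
    exact hle.trans_lt hneg
  have hgram : (D * Hᵀ) * H = Matrix.diagonal fun k : Fin n => d k := by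
    ext k l
    rw [Matrix.mul_assoc, Matrix.diagonal_mul, Matrix.mul_apply]
    simp only [H, Matrix.transpose_apply, Matrix.of_apply]
    rw [Fin.sum_univ_eq_sum_range (fun i => helmert k i * helmert l i) n]
    rcases lt_trichotomy k l with h | rfl | h
    · simp_rw [mul_comm (helmert k _)]
      rw [sum_helmert_mul_helmert_of_lt h l.isLt, Matrix.diagonal_apply_ne _ h.ne, mul_zero]
    · rw [Matrix.diagonal_apply_eq]
      rcases eq_or_ne (k : ℕ) 0 with hk | hk
      · simp [hk, hd]
      · have : ((k : ℕ) : ℝ) ≠ 0 := by exact_mod_cast hk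
        rw [sum_helmert_mul_self hk k.isLt]
        field_simp
    · rw [sum_helmert_mul_helmert_of_lt h k.isLt, Matrix.diagonal_apply_ne _ h.ne', mul_zero]
  refine ⟨H * (D * Hᵀ), hsymm, fun i j hij => ?_, ?_, ?_⟩
  · rcases lt_or_gt_of_ne hij with h | h
    · exact hlt i j h
    · rw [← hsymm.apply]
      exact hlt j i h
  · rw [← Matrix.mulVec_mulVec]
    suffices h : (D * Hᵀ) *ᵥ (fun _ => (1 : ℝ)) = 0 by rw [h, Matrix.mulVec_zero]
    ext k
    simp only [Matrix.mulVec, dotProduct, D, H, Matrix.diagonal_mul, Matrix.transpose_apply,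
      Matrix.of_apply, mul_one, Pi.zero_apply]
    rw [← Finset.mul_sum, Fin.sum_univ_eq_sum_range (fun i => helmert k i) n]
    rcases eq_or_ne (k : ℕ) 0 with hk | hk
    · simp [hk]
    · rw [sum_helmert_eq_zero hk k.isLt, mul_zero]
  · rw [Matrix.charpoly_mul_comm, hgram, Matrix.charpoly_diagonal]

theorem exists_laplacian_with_prescribed_spectrum {n : ℕ} (hn : 2 ≤ n)
    (lam : Fin (n - 1) → ℝ)
    (hmono : ∀ i j : Fin (n - 1), i ≤ j → lam j ≤ lam i)
    (hpos : ∀ i, 0 < lam i) :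
    ∃ L : Matrix (Fin n) (Fin n) ℝ,
      L.IsSymm ∧ (∀ i j, i ≠ j → L i j < 0) ∧ (L *ᵥ (fun _ => (1 : ℝ)) = 0) ∧
      L.charpoly = Polynomial.X * ∏ i : Fin (n - 1), (Polynomial.X - Polynomial.C (lam i)) := by
  obtain ⟨m, rfl⟩ : ∃ m, n = m + 1 := ⟨n - 1, by omega⟩
  change Fin m → ℝ at lam
  let d : ℕ → ℝ := fun k => if k = 0 then 0 else if h : k - 1 < m then lam ⟨k - 1, h⟩ else 0
  obtain ⟨L, h1, h2, h3, h4⟩ := exists_laplacian_charpoly_eq_prod (n := m + 1) (d := d) rfl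
    (by
      intro j k hj hjk
      have hk : k ≠ 0 := by omega
      simp only [d, hj, hk, if_false]
      split_ifs with hkm hjm hjm
      · exact hmono _ _ (Fin.mk_le_mk.mpr (by omega))
      · omega
      · exact (hpos _).le
      · exact le_rfl)
    (by
      intro k hk hkm
      have : k - 1 < m := by omega
      simp only [d, hk, this, if_false, dif_pos]
      exact hpos _)
  refine ⟨L, h1, h2, h3, ?_⟩
  rw [h4, Fin.prod_univ_succ]
  simp [d]
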